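/- Let C be an n×m real matrix encoding a hypergraph with real coefficients, and assume every vertex has positive degree, i.e. deg(i) = ∑_{e=1}^m (C i e)^2 > 0 for every i. Then for every k ∈ {1,…,n}, the k-th smallest eigenvalue of the normalized Laplacian L satisfies λ_k(L) = min over all subspaces X ⊆ ℝ^n with dim X = n−k of ( max over all nonzero y ∈ ℝ^n with y ⊥ X of [ ∑_{e=1}^m ( ∑_{i=1}^n y_i · C i e )^2 ] / [ ∑_{i=1}^n y_i^2 · deg(i) ] ). -/

import Mathlib

/-- The degree of vertex `i` in the hypergraph with real coefficients encoded by
the incidence matrix `C`: `deg i = ∑ e, (C i e)^2`. -/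
noncomputable def hypDeg {n : ℕ} {E : Type*} [Fintype E] (C : Matrix (Fin n) E ℝ) (i : Fin n) :
    ℝ :=
  ∑ e, (C i e) ^ 2

/-- The adjacency matrix of the hypergraph with real coefficients encoded by `C`:
zero on the diagonal and `A i j = -∑ e, C i e * C j e` off the diagonal. -/
noncomputable def hypAdj {n : ℕ} {E : Type*} [Fintype E] (C : Matrix (Fin n) E ℝ) :
    Matrix (Fin n) (Fin n) ℝ :=
  Matrix.of fun i j => if i = j then 0 else -∑ e, C i e * C j e

/-- The normalized Laplacian `L = I - D^{-1/2} A D^{-1/2}`. -/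
noncomputable def hypNormLap {n : ℕ} {E : Type*} [Fintype E] (C : Matrix (Fin n) E ℝ) :
    Matrix (Fin n) (Fin n) ℝ :=
  1 - Matrix.diagonal (fun i => (Real.sqrt (hypDeg C i))⁻¹) * hypAdj C *
      Matrix.diagonal (fun i => (Real.sqrt (hypDeg C i))⁻¹)

open Classical in
/-- The eigenvalues of a real symmetric matrix, listed in nondecreasing order with
multiplicity; `sortedEig A k` is the `(k+1)`-st smallest eigenvalue (0-indexed).
(Junk value `0` if `A` is not symmetric.) -/
noncomputable def sortedEig {n : ℕ} (A : Matrix (Fin n) (Fin n) ℝ) : Fin n → ℝ :=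
  if hA : A.IsHermitian then hA.eigenvalues ∘ Tuple.sort hA.eigenvalues else 0

open Matrix in
lemma hypNormLap_apply {n m : ℕ} (C : Matrix (Fin n) (Fin m) ℝ)
    (hdeg : ∀ i, 0 < hypDeg C i) (i j : Fin n) :
    Real.sqrt (hypDeg C i) * hypNormLap C i j * Real.sqrt (hypDeg C j) = ∑ e, C i e * C j e := by
  have hi := (Real.sqrt_pos.2 (hdeg i)).ne'
  have hj := (Real.sqrt_pos.2 (hdeg j)).ne'
  unfold hypNormLap
  rw [Matrix.sub_apply, Matrix.mul_diagonal, Matrix.diagonal_mul]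
  by_cases h : i = j
  · subst h
    simp only [hypAdj, Matrix.of_apply, if_true, Matrix.one_apply_eq, mul_zero, zero_mul, sub_zero,
      mul_one]
    rw [Real.mul_self_sqrt (hdeg i).le]
    simp [hypDeg, sq]
  · simp only [hypAdj, Matrix.of_apply, if_neg h, Matrix.one_apply_ne h]
    field_simp
    ring

lemma hypNormLap_herm {n m : ℕ} (C : Matrix (Fin n) (Fin m) ℝ)
    (hdeg : ∀ i, 0 < hypDeg C i) : (hypNormLap C).IsHermitian := by
  ext i j
  have h1 := hypNormLap_apply C hdeg i j
  have h2 := hypNormLap_apply C hdeg j i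
  have hi := (Real.sqrt_pos.2 (hdeg i))
  have hj := (Real.sqrt_pos.2 (hdeg j))
  have h3 : ∑ e, C i e * C j e = ∑ e, C j e * C i e := by simp_rw [mul_comm]
  rw [Matrix.conjTranspose_apply, star_trivial]
  apply mul_left_cancel₀ (mul_pos hi hj).ne'
  linarith

lemma herm_quad {n : ℕ} (A : Matrix (Fin n) (Fin n) ℝ) (hA : A.IsHermitian) (z : Fin n → ℝ) :
    ∑ i, ∑ j, z i * A i j * z j
      = ∑ l, hA.eigenvalues l * (∑ i, hA.eigenvectorBasis l i * z i) ^ 2 := by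
  have h := hA.eigenvectorBasis.sum_inner_mul_inner (WithLp.toLp 2 z) (WithLp.toLp 2 (A.mulVec z))
  have e1 : inner ℝ (WithLp.toLp 2 z) (WithLp.toLp 2 (A.mulVec z)) =
      ∑ i, ∑ j, z i * A i j * z j := by
    simp only [PiLp.inner_apply, RCLike.inner_apply, conj_trivial, Matrix.mulVec, dotProduct,
      Finset.sum_mul]
    exact Finset.sum_congr rfl fun i _ => Finset.sum_congr rfl fun j _ => by ring
  rw [← e1, ← h]
  refine Finset.sum_congr rfl fun l _ => ?_
  have e2 : inner ℝ (WithLp.toLp 2 z) (hA.eigenvectorBasis l) =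
      ∑ i, hA.eigenvectorBasis l i * z i := by
    simp [PiLp.inner_apply]
  have e3 : inner ℝ (hA.eigenvectorBasis l) (WithLp.toLp 2 (A.mulVec z)) =
      hA.eigenvalues l * ∑ i, hA.eigenvectorBasis l i * z i := by
    have h4 := hA.mulVec_eigenvectorBasis l
    have h5 : ∀ j, ∑ i, A j i * hA.eigenvectorBasis l i
        = hA.eigenvalues l * hA.eigenvectorBasis l j := fun j => congrFun h4 j
    simp only [PiLp.inner_apply, RCLike.inner_apply, conj_trivial, Matrix.mulVec, dotProduct,
      Finset.sum_mul, Finset.mul_sum]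
    rw [Finset.sum_comm]
    refine Finset.sum_congr rfl fun j _ => ?_
    rw [← mul_assoc, ← h5 j, Finset.sum_mul]
    refine Finset.sum_congr rfl fun i _ => ?_
    have : A i j = A j i := by simpa using (hA.apply j i)
    rw [this]; ring
  rw [e2, e3]; ring

lemma herm_parseval {n : ℕ} (A : Matrix (Fin n) (Fin n) ℝ) (hA : A.IsHermitian) (z : Fin n → ℝ) :
    ∑ i, z i ^ 2 = ∑ l, (∑ i, hA.eigenvectorBasis l i * z i) ^ 2 := by
  have h := hA.eigenvectorBasis.sum_inner_mul_inner (WithLp.toLp 2 z) (WithLp.toLp 2 z)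
  simp only [PiLp.inner_apply, RCLike.inner_apply, conj_trivial] at h
  simp only [sq]
  rw [← h]
  refine Finset.sum_congr rfl fun l _ => ?_
  congr 1
  exact Finset.sum_congr rfl fun i _ => mul_comm _ _

lemma exists_perp {n : ℕ} (Z : Submodule ℝ (Fin n → ℝ)) (hZ : Module.finrank ℝ Z < n) :
    ∃ y : Fin n → ℝ, y ≠ 0 ∧ ∀ x ∈ Z, ∑ i, y i * x i = 0 := by
  have hlt : Z < ⊤ := by
    rw [lt_top_iff_ne_top]
    rintro rfl
    simp at hZ
  obtain ⟨f, hf, hle⟩ := Submodule.exists_le_ker_of_lt_top Z hlt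
  have key : ∀ x, f x = ∑ i, f (Pi.single i 1) * x i := by
    intro x
    rw [LinearMap.pi_apply_eq_sum_univ f x]
    refine Finset.sum_congr rfl fun i _ => ?_
    rw [smul_eq_mul, mul_comm]
    congr 2
    ext j
    simp [Pi.single_apply, eq_comm]
  refine ⟨fun i => f (Pi.single i 1), ?_, ?_⟩
  · intro h
    apply hf
    ext x
    simpa using congrFun h x
  · intro x hx
    rw [← key]
    exact hle hx

lemma abstract_minmax {n : ℕ} (w : Fin n → Fin n → ℝ) (hw : LinearIndependent ℝ w)
    (lam : Fin n → ℝ) (hlam : Monotone lam) (N Q : (Fin n → ℝ) → ℝ)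
    (hN : ∀ y, N y = ∑ l, lam l * (∑ i, y i * w l i) ^ 2)
    (hQ : ∀ y, Q y = ∑ l, (∑ i, y i * w l i) ^ 2)
    (hpos : ∀ y, y ≠ 0 → 0 < Q y)
    (k : ℕ) (hk1 : 1 ≤ k) (hk2 : k ≤ n) (hk3 : k - 1 < n) :
    lam ⟨k - 1, hk3⟩ =
      sInf { M : ℝ | ∃ X : Submodule ℝ (Fin n → ℝ), Module.finrank ℝ X = n - k ∧
        M = sSup { r : ℝ | ∃ y : Fin n → ℝ, y ≠ 0 ∧ (∀ x ∈ X, ∑ i, y i * x i = 0) ∧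
          r = N y / Q y } } := by
  have hex : ∀ X : Submodule ℝ (Fin n → ℝ), Module.finrank ℝ X = n - k →
      ∃ y : Fin n → ℝ, y ≠ 0 ∧ (∀ x ∈ X, ∑ i, y i * x i = 0) ∧
        lam ⟨k - 1, hk3⟩ ≤ N y / Q y := by
    intro X hX
    let S : Submodule ℝ (Fin n → ℝ) :=
      Submodule.span ℝ (Set.range fun j : Fin (k - 1) => w ⟨j, by omega⟩)
    have hS : Module.finrank ℝ S ≤ k - 1 := by
      have := finrank_range_le_card (R := ℝ) (fun j : Fin (k - 1) => w ⟨j, by omega⟩)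
      rw [Fintype.card_fin] at this
      exact this
    have hZ : Module.finrank ℝ (X ⊔ S : Submodule ℝ (Fin n → ℝ)) < n := by
      have := Submodule.finrank_add_le_finrank_add_finrank X S
      omega
    obtain ⟨y, hy0, hy⟩ := exists_perp _ hZ
    refine ⟨y, hy0, fun x hx => hy x (Submodule.mem_sup_left hx), ?_⟩
    rw [le_div_iff₀ (hpos y hy0), hN, hQ, Finset.mul_sum]
    refine Finset.sum_le_sum fun l _ => ?_
    by_cases hl : (l : ℕ) < k - 1
    · have : ∑ i, y i * w l i = 0 :=
        hy _ (Submodule.mem_sup_right (Submodule.subset_span ⟨⟨l, hl⟩, rfl⟩))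
      simp [this]
    · refine mul_le_mul_of_nonneg_right (hlam ?_) (sq_nonneg _)
      rw [Fin.le_def]
      simp only
      omega
  have hbdd : ∀ X : Submodule ℝ (Fin n → ℝ), BddAbove { r : ℝ | ∃ y : Fin n → ℝ, y ≠ 0 ∧
      (∀ x ∈ X, ∑ i, y i * x i = 0) ∧ r = N y / Q y } := by
    intro X
    refine ⟨lam ⟨n - 1, by omega⟩, ?_⟩
    rintro r ⟨y, hy0, -, rfl⟩
    rw [div_le_iff₀ (hpos y hy0), hN, hQ, Finset.mul_sum]
    refine Finset.sum_le_sum fun l _ => ?_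
    refine mul_le_mul_of_nonneg_right (hlam ?_) (sq_nonneg _)
    rw [Fin.le_def]
    simp only
    omega
  have hlow : ∀ X : Submodule ℝ (Fin n → ℝ), Module.finrank ℝ X = n - k →
      lam ⟨k - 1, hk3⟩ ≤ sSup { r : ℝ | ∃ y : Fin n → ℝ, y ≠ 0 ∧
      (∀ x ∈ X, ∑ i, y i * x i = 0) ∧ r = N y / Q y } := by
    intro X hX
    obtain ⟨y, hy0, hy, hle⟩ := hex X hX
    exact hle.trans (le_csSup (hbdd X) ⟨y, hy0, hy, rfl⟩)
  symm
  apply IsLeast.csInf_eq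
  constructor
  · let v : Fin (n - k) → Fin n → ℝ := fun j => w ⟨k + j, by omega⟩
    have hv : LinearIndependent ℝ v := by
      refine hw.comp (fun j : Fin (n - k) => (⟨k + j, by omega⟩ : Fin n)) ?_
      intro a b hab
      have := congrArg Fin.val hab
      simp only at this
      ext
      omega
    have hX : Module.finrank ℝ (Submodule.span ℝ (Set.range v)) = n - k := by
      simpa using finrank_span_eq_card hv
    refine ⟨_, hX, le_antisymm (hlow _ hX) ?_⟩
    obtain ⟨y0, hy0, hy0', -⟩ := hex _ hX
    refine csSup_le ⟨_, y0, hy0, hy0', rfl⟩ ?_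
    rintro r ⟨y, hy0, hy, rfl⟩
    rw [div_le_iff₀ (hpos y hy0), hN, hQ, Finset.mul_sum]
    refine Finset.sum_le_sum fun l _ => ?_
    by_cases hl : (l : ℕ) < k
    · refine mul_le_mul_of_nonneg_right (hlam ?_) (sq_nonneg _)
      rw [Fin.le_def]
      simp only
      omega
    · have : ∑ i, y i * w l i = 0 := by
        apply hy
        apply Submodule.subset_span
        refine ⟨⟨l - k, by omega⟩, ?_⟩
        simp only [v]
        congr 1
        ext
        simp only
        omega
      simp [this]
  · rintro M ⟨X, hX, rfl⟩
    exact hlow X hX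

/-- Min-max characterization of the eigenvalues of the normalized Laplacian. -/
theorem normLap_minmax {n m : ℕ} (C : Matrix (Fin n) (Fin m) ℝ)
    (hdeg : ∀ i, 0 < hypDeg C i) (k : ℕ) (hk1 : 1 ≤ k) (hk2 : k ≤ n) :
    sortedEig (hypNormLap C) ⟨k - 1, by omega⟩ =
      sInf { M : ℝ | ∃ X : Submodule ℝ (Fin n → ℝ), Module.finrank ℝ X = n - k ∧
        M = sSup { r : ℝ | ∃ y : Fin n → ℝ, y ≠ 0 ∧ (∀ x ∈ X, ∑ i, y i * x i = 0) ∧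
          r = (∑ e, (∑ i, y i * C i e) ^ 2) / (∑ i, (y i) ^ 2 * hypDeg C i) } } := by
  have hA := hypNormLap_herm C hdeg
  have hs := fun i => Real.sqrt_pos.2 (hdeg i)
  let σ := Tuple.sort hA.eigenvalues
  have hlam : sortedEig (hypNormLap C) = hA.eigenvalues ∘ σ := by
    unfold sortedEig
    rw [dif_pos hA]
  rw [hlam]
  refine abstract_minmax
    (fun l i => Real.sqrt (hypDeg C i) * hA.eigenvectorBasis (σ l) i) ?_ _
    (Tuple.monotone_sort _) (fun y => ∑ e, (∑ i, y i * C i e) ^ 2)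
    (fun y => ∑ i, (y i) ^ 2 * hypDeg C i) ?_ ?_ ?_ k hk1 hk2 _
  · rw [Fintype.linearIndependent_iff]
    intro g hg
    have h1 := hA.eigenvectorBasis.orthonormal.linearIndependent.comp σ σ.injective
    rw [Fintype.linearIndependent_iff] at h1
    apply h1
    ext i
    have h2 := congrFun hg i
    simp only [Finset.sum_apply, Pi.smul_apply, smul_eq_mul, Pi.zero_apply] at h2
    have h3 : Real.sqrt (hypDeg C i) * ∑ l, g l * hA.eigenvectorBasis (σ l) i = 0 := by
      rw [← h2, Finset.mul_sum]
      exact Finset.sum_congr rfl fun l _ => by ring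
    simpa [(hs i).ne'] using h3
  · intro y
    have h := herm_quad _ hA (fun i => Real.sqrt (hypDeg C i) * y i)
    have h2 : ∑ l, (hA.eigenvalues ∘ σ) l *
        (∑ i, y i * (Real.sqrt (hypDeg C i) * hA.eigenvectorBasis (σ l) i)) ^ 2 =
        ∑ l, hA.eigenvalues l *
        (∑ i, hA.eigenvectorBasis l i * (Real.sqrt (hypDeg C i) * y i)) ^ 2 := by
      rw [← Equiv.sum_comp σ (fun l => hA.eigenvalues l *
        (∑ i, hA.eigenvectorBasis l i * (Real.sqrt (hypDeg C i) * y i)) ^ 2)]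
      refine Finset.sum_congr rfl fun l _ => ?_
      simp only [Function.comp]
      congr 2
      exact Finset.sum_congr rfl fun i _ => by ring
    simp only
    rw [h2, ← h]
    have h3 : ∀ i j, Real.sqrt (hypDeg C i) * y i * hypNormLap C i j *
        (Real.sqrt (hypDeg C j) * y j) = ∑ e, (y i * C i e) * (y j * C j e) := by
      intro i j
      calc _ = y i * y j * (Real.sqrt (hypDeg C i) * hypNormLap C i j *
            Real.sqrt (hypDeg C j)) := by ring
        _ = _ := by
          rw [hypNormLap_apply C hdeg, Finset.mul_sum]
          exact Finset.sum_congr rfl fun e _ => by ring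
    simp_rw [h3, sq, Finset.sum_mul_sum]
    rw [Finset.sum_comm]
    refine Finset.sum_congr rfl fun i _ => ?_
    rw [Finset.sum_comm]
  · intro y
    have h := herm_parseval _ hA (fun i => Real.sqrt (hypDeg C i) * y i)
    rw [← Equiv.sum_comp σ
      (fun l => (∑ i, hA.eigenvectorBasis l i * (Real.sqrt (hypDeg C i) * y i)) ^ 2)] at h
    have h1 : ∑ i, (y i) ^ 2 * hypDeg C i = ∑ i, (Real.sqrt (hypDeg C i) * y i) ^ 2 := by
      refine Finset.sum_congr rfl fun i _ => ?_
      rw [mul_pow, Real.sq_sqrt (hdeg i).le, mul_comm]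
    simp only
    rw [h1, h]
    refine Finset.sum_congr rfl fun l _ => ?_
    congr 1
    exact Finset.sum_congr rfl fun i _ => by ring
  · intro y hy
    obtain ⟨i, hi⟩ := Function.ne_iff.1 hy
    refine Finset.sum_pos' (fun j _ => mul_nonneg (sq_nonneg _) (hdeg j).le)
      ⟨i, Finset.mem_univ _, mul_pos (sq_pos_of_ne_zero hi) (hdeg i)⟩
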